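/- Let F ∈ R^{l×m} be of normal rank r, where R = K[x_1,...,x_n]. If J_r(F) = R, then F can be decomposed as F = G · F_1 with F_1 ∈ R^{r×m} a zero left prime (ZLP) matrix, G ∈ R^{l×r}, and J_r(G) = R. -/

import Mathlib

open Matrix MvPolynomial

/-- The set of `k × k` minors of a matrix: determinants of submatrices obtained by
choosing `k` rows and `k` columns. -/
def minorsSet {R : Type*} [CommRing R] {l m : ℕ} (k : ℕ)
    (F : Matrix (Fin l) (Fin m) R) : Set R :=
  { d | ∃ (ri : Fin k → Fin l) (ci : Fin k → Fin m),
      Function.Injective ri ∧ Function.Injective ci ∧ d = (F.submatrix ri ci).det }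

/-- `d` is a greatest common divisor of the `k × k` minors of `F`. -/
def IsGcdMinors {R : Type*} [CommRing R] {l m : ℕ} (k : ℕ)
    (F : Matrix (Fin l) (Fin m) R) (d : R) : Prop :=
  (∀ a ∈ minorsSet k F, d ∣ a) ∧ ∀ e : R, (∀ a ∈ minorsSet k F, e ∣ a) → e ∣ d

/-- `J_k(F) = R` : the ideal generated by the reduced `k`-th order minors
(the `k × k` minors divided by their g.c.d.) is the unit ideal. -/
def JEqTop {R : Type*} [CommRing R] {l m : ℕ} (k : ℕ)
    (F : Matrix (Fin l) (Fin m) R) : Prop :=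
  ∃ d : R, IsGcdMinors k F d ∧ Ideal.span { b : R | d * b ∈ minorsSet k F } = ⊤

/-- The normal rank of a polynomial matrix: its rank over the fraction field. -/
noncomputable def normalRank {K : Type*} [Field K] {n l m : ℕ}
    (F : Matrix (Fin l) (Fin m) (MvPolynomial (Fin n) K)) : ℕ :=
  (F.map (algebraMap (MvPolynomial (Fin n) K)
      (FractionRing (MvPolynomial (Fin n) K)))).rank

/-- Equivalence of matrices: `G = M * F * N` with `M`, `N` unimodular
(i.e. with determinant a unit, a nonzero constant). -/
def MatEquiv {R : Type*} [CommRing R] {l m : ℕ}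
    (F G : Matrix (Fin l) (Fin m) R) : Prop :=
  ∃ (M : Matrix (Fin l) (Fin l) R) (N : Matrix (Fin m) (Fin m) R),
    IsUnit M.det ∧ IsUnit N.det ∧ G = M * F * N

/-- A matrix is zero left prime (ZLP) if its maximal (row-size) order minors
generate the unit ideal. -/
def ZLP {R : Type*} [CommRing R] {l m : ℕ} (F : Matrix (Fin l) (Fin m) R) : Prop :=
  Ideal.span (minorsSet l F) = ⊤

universe u

namespace Matrix

variable {ι R : Type*} [Fintype ι] [DecidableEq ι] [CommRing R]

/-- Two column vectors are similar if an invertible matrix maps the first to the second. -/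
def VecSimilar (v w : ι → R) : Prop := ∃ M : GL ι R, (M : Matrix ι ι R) *ᵥ v = w

namespace VecSimilar

theorem of_isUnit_det {v w : ι → R} (M : Matrix ι ι R) (hM : IsUnit M.det) (h : M *ᵥ v = w) :
    VecSimilar v w :=
  ⟨GeneralLinearGroup.mk'' M hM, h⟩

theorem refl (v : ι → R) : VecSimilar v v := ⟨1, by simp⟩

theorem trans {u v w : ι → R} (h₁ : VecSimilar u v) (h₂ : VecSimilar v w) : VecSimilar u w := by
  obtain ⟨M, rfl⟩ := h₁
  obtain ⟨N, rfl⟩ := h₂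
  exact ⟨N * M, by simp [mulVec_mulVec]⟩

theorem symm {v w : ι → R} (h : VecSimilar v w) : VecSimilar w v := by
  obtain ⟨M, rfl⟩ := h
  refine ⟨M⁻¹, ?_⟩
  rw [mulVec_mulVec, ← Units.val_mul]
  simp

theorem map {S : Type*} [CommRing S] (f : R →+* S) {v w : ι → R} (h : VecSimilar v w) :
    VecSimilar (f ∘ v) (f ∘ w) := by
  obtain ⟨M, rfl⟩ := h
  refine ⟨GeneralLinearGroup.map f M, ?_⟩
  ext i
  exact (RingHom.map_mulVec f _ v i).symm

/-- Adding to the `j`-th entry a linear combination of the other entries. -/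
theorem add_single (v z : ι → R) (j : ι) (hz : z j = 0) :
    VecSimilar v (v + Pi.single j (z ⬝ᵥ v)) := by
  refine of_isUnit_det (1 + replicateCol Unit (Pi.single j 1 : ι → R) * replicateRow Unit z) ?_ ?_
  · rw [det_one_add_mul_comm]
    simp [hz]
  · rw [add_mulVec, one_mulVec, ← mulVec_mulVec]
    congr 1
    ext k
    simp [mulVec, dotProduct, replicateCol, replicateRow, Pi.single_apply]

/-- Two vectors congruent modulo an element `u` of the ideal spanned by two of their entries
are similar, provided that `u` is expressed by congruent coefficients. -/
theorem of_dvd_sub [IsDomain R] {v w : ι → R} {i j : ι} (hij : i ≠ j) {u a b a' b' : R}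
    (hv : a * v i + b * v j = u) (hw : a' * w i + b' * w j = u)
    (h : ∀ k, u ∣ w k - v k) (ha : u ∣ a' - a) (hb : u ∣ b' - b) : VecSimilar v w := by
  rcases eq_or_ne u 0 with rfl | hu
  · have : v = w := by
      ext k
      exact (sub_eq_zero.mp (zero_dvd_iff.mp (h k))).symm
    exact this ▸ refl v
  choose e he using h
  obtain ⟨p, hp⟩ := ha
  obtain ⟨q, hq⟩ := hb
  let U : Matrix ι (Fin 2) R := of fun k => ![e k, (Pi.single i (-q) + Pi.single j p : ι → R) k]
  let V : Matrix (Fin 2) ι R :=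
    of ![Pi.single i a + Pi.single j b, Pi.single i (-v j) + Pi.single j (v i)]
  refine of_isUnit_det (1 + U * V) ?_ ?_
  · have hdet : u * u * (1 + U * V).det = u * u * 1 := by
      have hVU : V * U = !![a * e i + b * e j, -(a * q) + b * p;
          -(v j * e i) + v i * e j, v j * q + v i * p] := by
        ext s t
        fin_cases s <;> fin_cases t <;>
          simp [U, V, Matrix.mul_apply, add_mul, Pi.single_apply, Finset.sum_add_distrib,
            hij, hij.symm]
      rw [det_one_add_mul_comm, hVU, ← Matrix.one_fin_two.symm, det_fin_two]
      have h1 := he i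
      have h2 := he j
      have e1 : u * e i = w i - v i := h1.symm
      have e2 : u * e j = w j - v j := h2.symm
      have key : u * u * ((1 + (a * e i + b * e j)) * (1 + (v j * q + v i * p)) -
          (-(a * q) + b * p) * (-(v j * e i) + v i * e j)) =
          (u + (a * (u * e i) + b * (u * e j))) * (u + (v j * (u * q) + v i * (u * p))) -
          (-(a * (u * q)) + b * (u * p)) * (-(v j * (u * e i)) + v i * (u * e j)) := by ring
      have goal : u * u * ((1 + (a * e i + b * e j)) * (1 + (v j * q + v i * p)) -
          (-(a * q) + b * p) * (-(v j * e i) + v i * e j)) = u * u * 1 := by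
        rw [key, e1, e2, ← hp, ← hq]
        have r1 : u + (a * (w i - v i) + b * (w j - v j)) = a * w i + b * w j := by
          rw [← hv]; ring
        have r2 : u + (v j * (b' - b) + v i * (a' - a)) = v j * b' + v i * a' := by
          rw [← hv]; ring
        rw [r1, r2]
        have : (a * w i + b * w j) * (v j * b' + v i * a') -
          (-(a * (b' - b)) + b * (a' - a)) * (-(v j * (w i - v i)) + v i * (w j - v j))
          = (a * v i + b * v j) * (a' * w i + b' * w j) := by ring
        rw [this, hv, hw, mul_one]
      simpa using goal
    rw [mul_left_cancel₀ (mul_ne_zero hu hu) hdet]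
    exact isUnit_one
  · rw [add_mulVec, one_mulVec, ← mulVec_mulVec]
    have hV : V *ᵥ v = ![u, 0] := by
      ext s
      fin_cases s
      · simp [V, mulVec, dotProduct, add_mul, Pi.single_apply, Finset.sum_add_distrib, hv]
      · simp [V, mulVec, dotProduct, add_mul, Pi.single_apply, Finset.sum_add_distrib]
        ring
    ext k
    rw [Pi.add_apply, hV]
    simp only [mulVec, dotProduct, Fin.sum_univ_two, U, of_apply, cons_val_zero, cons_val_one,
      mul_zero, add_zero]
    rw [mul_comm, ← he k]
    ring

end VecSimilar

end Matrix

/-- In a principal ideal domain, if `p ≠ 0`, `q`, `r` generate the unit ideal, then so do `p` and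
`q + c * r` for a suitable `c`. -/
theorem exists_isCoprime_add_mul {R : Type*} [CommRing R] [IsDomain R] [IsPrincipalIdealRing R]
    {p q r : R} (hp : p ≠ 0) (h : ∃ x y z, x * p + y * q + z * r = 1) :
    ∃ c, IsCoprime p (q + c * r) := by
  classical
  let S := (UniqueFactorizationMonoid.factors p).filter fun s => ¬ s ∣ q
  refine ⟨S.prod, isCoprime_of_prime_dvd (fun h => hp h.1) fun s hs hsp hsd => ?_⟩
  by_cases hsq : s ∣ q
  · have h2 : s ∣ S.prod * r := (dvd_add_right hsq).mp hsd
    rcases hs.dvd_or_dvd h2 with h3 | h3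
    · obtain ⟨t, ht, hst⟩ := hs.exists_mem_multiset_dvd h3
      obtain ⟨ht1, ht2⟩ := Multiset.mem_filter.mp ht
      have htp := UniqueFactorizationMonoid.prime_of_factor t ht1
      exact ht2 ((hs.associated_of_dvd htp hst).symm.dvd.trans hsq)
    · obtain ⟨x, y, z, hxyz⟩ := h
      apply hs.not_isUnit
      apply isUnit_of_dvd_one
      rw [← hxyz]
      exact dvd_add (dvd_add (hsp.mul_left _) (hsq.mul_left _)) (h3.mul_left _)
  · obtain ⟨t, ht, hst⟩ := UniqueFactorizationMonoid.exists_mem_factors_of_dvd hp hs.irreducible hsp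
    have : t ∈ S := Multiset.mem_filter.mpr ⟨ht, fun h => hsq (hst.dvd.trans h)⟩
    have h2 : s ∣ S.prod * r := (hst.dvd.trans (Multiset.dvd_prod this)).mul_right _
    exact hsq ((dvd_add_left h2).mp hsd)

open Polynomial in
/-- If a monic polynomial `p` and a polynomial `q` are coprime modulo a maximal ideal, then the
ideal `(p, q)` contains a constant outside that maximal ideal. -/
theorem exists_C_eq_of_isCoprime_map {A : Type*} [CommRing A] (m : Ideal A)
    {p q : A[X]} (hp : p.Monic)
    (h : IsCoprime (p.map (Ideal.Quotient.mk m)) (q.map (Ideal.Quotient.mk m))) :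
    ∃ u, u - 1 ∈ m ∧ ∃ a b : A[X], a * p + b * q = Polynomial.C u := by
  let I : Ideal A[X] := Ideal.span {p, q}
  have hfin : Module.Finite A (A[X] ⧸ I) := by
    have := hp.finite_quotient
    have hle : Ideal.span {p} ≤ I := Ideal.span_mono (by simp)
    exact Module.Finite.of_surjective (Ideal.Quotient.factorₐ A hle).toLinearMap
      (Ideal.Quotient.factor_surjective hle)
  obtain ⟨u, hu, hu'⟩ := Submodule.exists_sub_one_mem_and_smul_eq_zero_of_fg_of_le_smul m
    (⊤ : Submodule A (A[X] ⧸ I)) hfin.fg_top (by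
      obtain ⟨a, b, hab⟩ := h
      obtain ⟨a, rfl⟩ := Polynomial.map_surjective _ Ideal.Quotient.mk_surjective a
      obtain ⟨b, rfl⟩ := Polynomial.map_surjective _ Ideal.Quotient.mk_surjective b
      have hmem : a * p + b * q - 1 ∈ m.map (Polynomial.C : A →+* A[X]) := by
        rw [← Ideal.mk_ker (I := m), ← Polynomial.ker_mapRingHom, RingHom.mem_ker]
        simpa [sub_eq_zero] using hab
      intro x _
      obtain ⟨x, rfl⟩ := Ideal.Quotient.mk_surjective x
      have hx : Ideal.Quotient.mk I x = Ideal.Quotient.mk I (x * (1 - (a * p + b * q))) := by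
        rw [Ideal.Quotient.eq]
        have : x - x * (1 - (a * p + b * q)) = x * a * p + x * b * q := by ring
        rw [this]
        exact Ideal.mem_span_pair.mpr ⟨_, _, rfl⟩
      rw [hx]
      have hmem' : x * (1 - (a * p + b * q)) ∈ m.map (Polynomial.C : A →+* A[X]) := by
        rw [← neg_sub]
        exact Ideal.mul_mem_left _ _ (neg_mem hmem)
      have h3 : x * (1 - (a * p + b * q)) ∈ m • (⊤ : Submodule A A[X]) := by
        have := Ideal.smul_top_eq_map (R := A) (S := A[X]) m
        rw [this]
        exact hmem'
      have h4 := Submodule.mem_map_of_mem (f := (Ideal.Quotient.mkₐ A I).toLinearMap) h3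
      rw [Submodule.map_smul''] at h4
      exact Submodule.smul_mono le_rfl le_top h4)
  refine ⟨u, hu, ?_⟩
  have h1 := hu' (Ideal.Quotient.mk I 1) trivial
  rw [← Ideal.Quotient.mkₐ_eq_mk A, ← map_smul, Ideal.Quotient.mkₐ_eq_mk,
    Ideal.Quotient.eq_zero_iff_mem, Algebra.smul_def, mul_one] at h1
  exact Ideal.mem_span_pair.mp h1

namespace Matrix.VecSimilar

open Polynomial

variable {ι A : Type*} [Fintype ι] [DecidableEq ι] [CommRing A]

/-- The ideal of constants `u` such that substituting congruent polynomials modulo `u` in `f`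
produces similar vectors. -/
def substIdeal (f : ι → A[X]) : Ideal A where
  carrier := {u | ∀ b t : A[X],
    VecSimilar (fun k => (f k).comp b) (fun k => (f k).comp (b + Polynomial.C u * t))}
  add_mem' {u u'} hu hu' b t := by
    have := (hu b t).trans (hu' (b + Polynomial.C u * t) t)
    rwa [add_assoc, ← add_mul, ← Polynomial.C_add] at this
  zero_mem' b t := by simpa using refl _
  smul_mem' a u hu b t := by
    have := hu b (Polynomial.C a * t)
    rwa [← mul_assoc, ← Polynomial.C_mul, mul_comm u a] at this

theorem substIdeal_le {f g : ι → A[X]} (h : VecSimilar f g) : substIdeal g ≤ substIdeal f := by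
  intro u hu b t
  have h₁ := h.map (compRingHom b)
  have h₂ := (h.map (compRingHom (b + Polynomial.C u * t))).symm
  exact (h₁.trans (hu b t)).trans h₂

theorem mem_substIdeal [IsDomain A] {f : ι → A[X]} {i j : ι} (hij : i ≠ j) {u : A} {a b : A[X]}
    (h : a * f i + b * f j = Polynomial.C u) : u ∈ substIdeal f := by
  intro x t
  have hdvd (p : A[X]) : Polynomial.C u ∣ p.comp (x + Polynomial.C u * t) - p.comp x := by
    have := Polynomial.sub_dvd_eval_sub (x + Polynomial.C u * t) x (p.map Polynomial.C)
    rw [add_sub_cancel_left, Polynomial.eval_map, Polynomial.eval_map] at this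
    exact (Dvd.intro _ rfl).trans this
  refine of_dvd_sub hij (u := Polynomial.C u) (a := a.comp x) (b := b.comp x)
    (a' := a.comp (x + Polynomial.C u * t)) (b' := b.comp (x + Polynomial.C u * t)) ?_ ?_
    (fun k => hdvd _) (hdvd _) (hdvd _)
  · simpa using congrArg (fun p => p.comp x) h
  · simpa using congrArg (fun p => p.comp (x + Polynomial.C u * t)) h

theorem exists_mem_substIdeal_notMem [IsDomain A] {f : ι → A[X]} {i j : ι} (hij : i ≠ j)
    (hi : (f i).Monic) {w : ι → A[X]} (hw : w ⬝ᵥ f = 1) (m : Ideal A) [m.IsMaximal] :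
    ∃ u ∈ substIdeal f, u ∉ m := by
  let := Ideal.Quotient.field m
  let z : ι → A[X] := fun k => if k = i ∨ k = j then 0 else w k
  have hz : w i * f i + w j * f j + z ⬝ᵥ f = 1 := by
    have : w = Pi.single i (w i) + Pi.single j (w j) + z := by
      ext1 k
      by_cases hki : k = i
      · subst hki; simp [z, hij]
      · by_cases hkj : k = j
        · subst hkj; simp [z, hij.symm]
        · simp [z, hki, hkj]
    rw [← hw, this]
    simp [add_dotProduct, z, hij, hij.symm]
  let π := Polynomial.mapRingHom (Ideal.Quotient.mk m)
  obtain ⟨c, hc⟩ := exists_isCoprime_add_mul (p := π (f i)) (q := π (f j)) (r := π (z ⬝ᵥ f))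
    (hi.map _).ne_zero ⟨π (w i), π (w j), 1, by rw [one_mul, ← map_mul, ← map_mul, ← map_add,
      ← map_add, hz, map_one]⟩
  obtain ⟨c, rfl⟩ := Polynomial.map_surjective _ Ideal.Quotient.mk_surjective c
  have hs := add_single f (c • z) j (by simp [z])
  set g := f + Pi.single j (c • z ⬝ᵥ f) with hg
  have hgi : g i = f i := by simp [hg, hij]
  have hgj : g j = f j + c * (z ⬝ᵥ f) := by simp [hg]
  obtain ⟨u, hu, a, b, hab⟩ := exists_C_eq_of_isCoprime_map m (p := g i) (q := g j)
    (hgi ▸ hi) (by rw [hgi, hgj]; simpa [π] using hc)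
  refine ⟨u, substIdeal_le hs (mem_substIdeal hij hab), fun hum => ?_⟩
  apply (Ideal.ne_top_iff_one m).mp (Ideal.IsMaximal.ne_top ‹_›)
  simpa using sub_mem hum hu

/-- A unimodular vector of polynomials with a monic entry is similar to the constant vector
obtained by evaluating at zero. -/
theorem eval_zero_of_monic [IsDomain A] {f : ι → A[X]} {i : ι}
    (hi : (f i).Monic) {w : ι → A[X]} (hw : w ⬝ᵥ f = 1) :
    VecSimilar f (fun k => Polynomial.C ((f k).eval 0)) := by
  by_cases hι : ∃ j, i ≠ j
  · obtain ⟨j, hij⟩ := hι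
    have htop : substIdeal f = ⊤ := by
      by_contra hne
      obtain ⟨m, hm, hle⟩ := Ideal.exists_le_maximal _ hne
      obtain ⟨u, hu, hum⟩ := exists_mem_substIdeal_notMem hij hi hw m
      exact hum (hle hu)
    have h1 : (1 : A) ∈ substIdeal f := htop ▸ trivial
    simpa [Polynomial.comp_zero] using h1 Polynomial.X (-Polynomial.X)
  · push Not at hι
    have hu : IsUnit (f i) := by
      refine IsUnit.of_mul_eq_one (w i) ?_
      rw [← hw, dotProduct, Finset.sum_eq_single i (fun k _ hk => absurd (hι k).symm hk) (by simp),
        mul_comm]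
    have h1 := hi.eq_one_of_isUnit hu
    have : (fun k => Polynomial.C ((f k).eval 0)) = f := by
      ext1 k
      rw [← hι k, h1]
      simp
    rw [this]
    exact refl f

end Matrix.VecSimilar

/-- Every finitely generated projective module is free. -/
def ProjectivesFree (A : Type u) [CommRing A] : Prop :=
  ∀ (P : Type u) [AddCommGroup P] [Module A P] [Module.Finite A P] [Module.Projective A P],
    Module.Free A P

/-- Every unimodular vector can be moved to a standard basis vector by an invertible matrix. -/
def UnimodularVectorsSplit (A : Type u) [CommRing A] : Prop :=
  ∀ (ι : Type) [Fintype ι] [DecidableEq ι] (v w : ι → A), w ⬝ᵥ v = 1 →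
    ∃ i, VecSimilar v (Pi.single i 1)

theorem ProjectivesFree.unimodularVectorsSplit {A : Type u} [CommRing A] [Nontrivial A]
    (hA : ProjectivesFree A) : UnimodularVectorsSplit A := by
  intro ι _ _ v w hwv
  let φ : (ι → A) →ₗ[A] A :=
    { toFun := fun x => w ⬝ᵥ x
      map_add' := fun x y => dotProduct_add _ _ _
      map_smul' := fun a x => dotProduct_smul _ _ _ }
  have hφ : φ v = 1 := hwv
  let π : (ι → A) →ₗ[A] LinearMap.ker φ :=
    (LinearMap.id - φ.smulRight v).codRestrict _ fun x => by simp [hφ]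
  have hπ_apply (x) : (π x : ι → A) = x - φ x • v := rfl
  have hπ : π ∘ₗ (LinearMap.ker φ).subtype = LinearMap.id := by
    ext x
    simp [hπ_apply]
  have : Module.Projective A (LinearMap.ker φ) := Module.Projective.of_split _ _ hπ
  have : Module.Finite A (LinearMap.ker φ) := Module.Finite.of_surjective π fun x =>
    ⟨x, LinearMap.congr_fun hπ x⟩
  have : Module.Free A (LinearMap.ker φ) := hA _
  let e : (LinearMap.ker φ × A) ≃ₗ[A] (ι → A) := LinearEquiv.ofLinearMap
    ((LinearMap.ker φ).subtype.coprod (LinearMap.toSpanSingleton A _ v)) (π.prod φ)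
    (by ext x; simp [hπ_apply])
    (by
      ext x
      · simp [hπ_apply]
      · simp
      · simp [hπ_apply, hφ]
      · simp [hφ])
  let b := ((Module.Free.chooseBasis A (LinearMap.ker φ)).prod (Module.Basis.singleton Unit A)).map e
  let σ := b.indexEquiv (Pi.basisFun A ι)
  let B := b.reindex σ
  refine ⟨σ (Sum.inr ()), ⟨LinearMap.toMatrix' B.equivFun.toLinearMap,
    LinearMap.toMatrix' B.equivFun.symm.toLinearMap, ?_, ?_⟩, ?_⟩
  · rw [← LinearMap.toMatrix'_comp]; simp
  · rw [← LinearMap.toMatrix'_comp]; simp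
  · have hB : B (σ (Sum.inr ())) = v := by simp [B, b, e]
    rw [LinearMap.toMatrix'_mulVec]
    nth_rw 1 [← hB]
    ext k
    simp [Pi.single_apply, eq_comm]

theorem UnimodularVectorsSplit.free_of_prod {R : Type u} [CommRing R] [Nontrivial R]
    (hR : UnimodularVectorsSplit R) {P : Type*} [AddCommGroup P] [Module R P]
    [Module.Finite R P] [Module.Free R (P × R)] : Module.Free R P := by
  let b := Module.finBasis R (P × R)
  let T₀ := b.equivFun
  obtain ⟨i, M, hM⟩ := hR _ (T₀ (0, 1))
    (fun k => (T₀.symm (Pi.single k 1)).2) (by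
      have h : (T₀.symm (T₀ (0, 1))).2 = 1 := by simp
      rw [← h]
      conv_rhs => rw [LinearEquiv.symm_apply_apply, ← LinearEquiv.symm_apply_apply T₀ (0, 1),
        pi_eq_sum_univ' (T₀ (0, 1))]
      simp [dotProduct, mul_comm, Prod.snd_sum])
  let T : (P × R) ≃ₗ[R] (Fin (Module.finrank R (P × R)) → R) :=
    T₀ ≪≫ₗ LinearEquiv.ofLinearMap (mulVecLin M.1) (mulVecLin M⁻¹.1)
      (by rw [← mulVecLin_mul, ← Units.val_mul]; simp)
      (by rw [← mulVecLin_mul, ← Units.val_mul]; simp)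
  have hT : T (0, 1) = Pi.single i 1 := hM
  have hT' : T.symm (Pi.single i 1) = (0, 1) := by rw [← hT, LinearEquiv.symm_apply_apply]
  let res : (Fin (Module.finrank R (P × R)) → R) →ₗ[R] ({k // k ≠ i} → R) :=
    LinearMap.funLeft R R Subtype.val
  let ext : ({k // k ≠ i} → R) →ₗ[R] (Fin (Module.finrank R (P × R)) → R) :=
    LinearMap.pi fun k => if h : k ≠ i then LinearMap.proj ⟨k, h⟩ else 0
  have hre (x) : res (ext x) = x := by
    ext k
    simp [res, ext, LinearMap.funLeft_apply, k.2]
  have her (x) : ext (res x) = x - x i • Pi.single i 1 := by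
    ext k
    by_cases h : k = i
    · subst h; simp [ext]
    · simp [ext, res, h, LinearMap.funLeft_apply]
  have hres : res (Pi.single i 1) = 0 := by
    ext k
    simp [res, LinearMap.funLeft_apply, k.2]
  refine Module.Free.of_equiv (M := {k // k ≠ i} → R) (LinearEquiv.ofLinearMap
    (LinearMap.fst R P R ∘ₗ T.symm.toLinearMap ∘ₗ ext)
    (res ∘ₗ T.toLinearMap ∘ₗ LinearMap.inl R P R) ?_ ?_)
  · ext1 p
    simp [her, hT']
  · refine LinearMap.ext fun x => ?_
    have h : (((T.symm (ext x)).1, 0) : P × R) = T.symm (ext x) - (T.symm (ext x)).2 • (0, 1) := by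
      ext <;> simp
    simp only [LinearMap.comp_apply, LinearMap.inl_apply, LinearMap.fst_apply,
      LinearEquiv.coe_coe, LinearMap.id_apply]
    rw [h, map_sub, map_smul, hT, LinearEquiv.apply_symm_apply, map_sub, hre, map_smul, hres]
    simp

theorem UnimodularVectorsSplit.free_of_prod_pi {R : Type u} [CommRing R] [Nontrivial R]
    (hR : UnimodularVectorsSplit R) {P : Type*} [AddCommGroup P] [Module R P]
    [Module.Finite R P] (s : ℕ) (h : Module.Free R (P × (Fin s → R))) : Module.Free R P := by
  induction s with
  | zero => exact Module.Free.of_equiv (LinearEquiv.prodUnique (R := R) (M := P) (M₂ := Fin 0 → R))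
  | succ s ih =>
    refine ih ?_
    have : Module.Free R ((P × (Fin s → R)) × R) := Module.Free.of_equiv
      ((LinearEquiv.refl R P).prodCongr
        ((Fin.consLinearEquiv R fun _ : Fin (s + 1) => R).symm ≪≫ₗ LinearEquiv.prodComm R _ _)
        ≪≫ₗ (LinearEquiv.prodAssoc R P (Fin s → R) R).symm)
    exact hR.free_of_prod

/-- **Schanuel's lemma**. -/
def schanuelEquiv {R P Q M : Type*} [CommRing R] [AddCommGroup P] [Module R P] [AddCommGroup Q]
    [Module R Q] [AddCommGroup M] [Module R M] (f : P →ₗ[R] M) (g : Q →ₗ[R] M)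
    (α : P →ₗ[R] Q) (β : Q →ₗ[R] P) (hα : g ∘ₗ α = f) (hβ : f ∘ₗ β = g) :
    (P × LinearMap.ker g) ≃ₗ[R] (Q × LinearMap.ker f) where
  toFun x := (α x.1 + x.2, ⟨x.1 - β (α x.1 + x.2), by
    have h1 : ∀ q, f (β q) = g q := LinearMap.congr_fun hβ
    have h2 : ∀ p, g (α p) = f p := LinearMap.congr_fun hα
    rw [LinearMap.mem_ker, map_sub, h1, map_add, h2, x.2.2]
    simp⟩)
  invFun y := (y.2 + β y.1, ⟨y.1 - α (y.2 + β y.1), by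
    have h1 : ∀ q, f (β q) = g q := LinearMap.congr_fun hβ
    have h2 : ∀ p, g (α p) = f p := LinearMap.congr_fun hα
    rw [LinearMap.mem_ker, map_sub, h2, map_add, h1, y.2.2]
    simp⟩)
  map_add' x y := by
    ext
    · simp only [Prod.fst_add, Prod.snd_add, map_add, Submodule.coe_add]; abel
    · simp only [Prod.fst_add, Prod.snd_add, map_add, Submodule.coe_add]; abel
  map_smul' a x := by
    ext <;> simp [smul_sub, smul_add]
  left_inv x := by ext <;> simp
  right_inv x := by ext <;> simp

section Presentation

open Polynomial

variable {A M : Type*} [CommRing A] [IsDomain A] [AddCommGroup M] [Module A M] [Module A[X] M]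
  [IsScalarTower A A[X] M] {s : ℕ} (B : Module.Basis (Fin s) A M)

/-- The polynomial relations between the elements of an `A`-basis of an `A[X]`-module form a
free `A[X]`-module. -/
theorem nonempty_equiv_ker_linearCombination_basis :
    Nonempty ((Fin s → A[X]) ≃ₗ[A[X]] LinearMap.ker (Fintype.linearCombination A[X] B)) := by
  let N : Matrix (Fin s) (Fin s) A :=
    LinearMap.toMatrix B B (Module.toModuleEnd A (S := A[X]) M Polynomial.X)
  let φ := Fintype.linearCombination A[X] B
  let θ := (charmatrix N).mulVecLin
  have hN (a : Fin s → A) :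
      ∑ j, (N *ᵥ a) j • B j = (Polynomial.X : A[X]) • ∑ j, a j • B j := by
    have h := LinearMap.toMatrix_mulVec_repr B B
      (Module.toModuleEnd A (S := A[X]) M Polynomial.X) (∑ j, a j • B j)
    have h2 : ⇑(B.repr (∑ j, a j • B j)) = a := by
      ext j
      simp [Finsupp.single_apply]
    rw [h2] at h
    rw [show N *ᵥ a = _ from h, B.sum_repr]
    rfl
  have hφC (a : Fin s → A) : φ (fun j => Polynomial.C (a j)) = ∑ j, a j • B j := by
    simp only [φ, Fintype.linearCombination_apply]
    refine Finset.sum_congr rfl fun j _ => ?_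
    rw [← Polynomial.algebraMap_eq, algebraMap_smul]
  have hθC (a : Fin s → A) : θ (fun j => Polynomial.C (a j)) =
      (Polynomial.X : A[X]) • (fun j => Polynomial.C (a j)) -
        fun j => Polynomial.C ((N *ᵥ a) j) := by
    ext1 j
    simp only [θ, charmatrix, mulVecLin_apply, sub_mulVec, Pi.sub_apply]
    congr 1
    · simp [Matrix.scalar_apply, mulVec_diagonal]
    · rw [RingHom.map_mulVec]
      rfl
  have hθ_inj : Function.Injective θ := by
    rw [← LinearMap.ker_eq_bot, LinearMap.ker_eq_bot']
    intro v hv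
    exact eq_zero_of_mulVec_eq_zero (charpoly_monic N).ne_zero hv
  have hφθ : φ ∘ₗ θ = 0 := by
    refine LinearMap.pi_ext' fun i => LinearMap.ext_ring ?_
    have h1 : (Pi.single i 1 : Fin s → A[X]) =
        fun j => Polynomial.C ((Pi.single i 1 : Fin s → A) j) := by
      ext1 j
      by_cases h : j = i <;> simp [h]
    simp only [LinearMap.comp_apply, LinearMap.single_apply, LinearMap.zero_apply]
    rw [h1, hθC, map_sub, map_smul, hφC, hφC, hN, sub_self]
  let W : Submodule A (Fin s → A[X]) :=
    (LinearMap.range θ).restrictScalars A ⊔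
      LinearMap.range ((Polynomial.CAlgHom (R := A) (A := A)).toLinearMap.compLeft (Fin s))
  have hWC (a : Fin s → A) : (fun j => Polynomial.C (a j)) ∈ W :=
    Submodule.mem_sup_right ⟨a, rfl⟩
  have hWX (v) (hv : v ∈ W) : (Polynomial.X : A[X]) • v ∈ W := by
    obtain ⟨_, ⟨y, rfl⟩, _, ⟨a, rfl⟩, rfl⟩ := Submodule.mem_sup.mp hv
    rw [smul_add]
    refine add_mem (Submodule.mem_sup_left ⟨Polynomial.X • y, map_smul _ _ _⟩) ?_
    have := hθC a
    rw [eq_sub_iff_add_eq] at this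
    change (Polynomial.X : A[X]) • (fun j => Polynomial.C (a j)) ∈ W
    rw [← this]
    exact add_mem (Submodule.mem_sup_left ⟨_, rfl⟩) (hWC _)
  have hWp (p : A[X]) (v) (hv : v ∈ W) : p • v ∈ W := by
    induction p using Polynomial.induction_on' with
    | add p q hp hq => rw [add_smul]; exact add_mem hp hq
    | monomial n a =>
      rw [← Polynomial.smul_X_eq_monomial, smul_assoc]
      refine W.smul_mem a ?_
      induction n with
      | zero => simpa using hv
      | succ n ih => rw [pow_succ', mul_smul]; exact hWX _ ih
  have hW (v) : v ∈ W := by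
    rw [pi_eq_sum_univ' v]
    refine sum_mem fun i _ => hWp _ _ ?_
    convert hWC (Pi.single i 1) using 2 with j
    by_cases h : j = i
    · subst h; simp
    · simp [h]
  have hrange : LinearMap.range θ = LinearMap.ker φ := by
    refine le_antisymm (LinearMap.range_le_ker_iff.mpr hφθ) fun v hv => ?_
    obtain ⟨_, ⟨y, rfl⟩, _, ⟨a, rfl⟩, rfl⟩ := Submodule.mem_sup.mp (hW v)
    have h0 : φ (fun j => Polynomial.C (a j)) = 0 := by
      have h1 : φ (θ y) = 0 := LinearMap.congr_fun hφθ y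
      have h2 : φ (θ y + fun j => Polynomial.C (a j)) = 0 := hv
      rwa [map_add, h1, zero_add] at h2
    rw [hφC] at h0
    have ha : a = 0 := funext (Fintype.linearIndependent_iff.mp B.linearIndependent a h0)
    subst ha
    refine ⟨y, ?_⟩
    ext1 j
    simp
  exact ⟨LinearEquiv.ofInjective θ hθ_inj ≪≫ₗ LinearEquiv.ofEq _ _ hrange⟩

end Presentation

section MonicDenominator

open Polynomial

variable {A : Type*} [CommRing A] [Nontrivial A]

/-- Division by a monic polynomial as a linear map over the coefficient ring. -/
noncomputable def divByMonicLinear (g : A[X]) (hg : g.Monic) : A[X] →ₗ[A] A[X] where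
  toFun p := p /ₘ g
  map_add' p q := by
    refine (Polynomial.div_modByMonic_unique (p /ₘ g + q /ₘ g) (p %ₘ g + q %ₘ g) hg ⟨?_, ?_⟩).1
    · nth_rw 3 [← Polynomial.modByMonic_add_div p g]
      nth_rw 3 [← Polynomial.modByMonic_add_div q g]
      ring
    · exact (Polynomial.degree_add_le _ _).trans_lt
        (max_lt (Polynomial.degree_modByMonic_lt _ hg) (Polynomial.degree_modByMonic_lt _ hg))
  map_smul' a p := by
    refine (Polynomial.div_modByMonic_unique (a • (p /ₘ g)) (a • (p %ₘ g)) hg ⟨?_, ?_⟩).1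
    · nth_rw 3 [← Polynomial.modByMonic_add_div p g]
      rw [smul_add, mul_smul_comm]
    · exact (Polynomial.degree_smul_le _ _).trans_lt (Polynomial.degree_modByMonic_lt _ hg)

/-- On a projective `A[X]`-module, multiplication by a monic polynomial has an `A`-linear left
inverse. -/
theorem exists_leftInverse_smul_of_monic {P : Type*} [AddCommGroup P] [Module A P] [Module A[X] P]
    [IsScalarTower A A[X] P] [Module.Finite A[X] P] [Module.Projective A[X] P] {g : A[X]}
    (hg : g.Monic) :
    ∃ h : P →ₗ[A] P, ∀ p, h (g • p) = p := by
  obtain ⟨n, q, i, -, -, hqi⟩ := Module.Finite.exists_comp_eq_id_of_projective A[X] P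
  refine ⟨q.restrictScalars A ∘ₗ (divByMonicLinear g hg).compLeft (Fin n) ∘ₗ i.restrictScalars A,
    fun p => ?_⟩
  have h1 : (divByMonicLinear g hg).compLeft (Fin n) (i (g • p)) = i p := by
    ext1 k
    simp [divByMonicLinear, Polynomial.mul_divByMonic_cancel_left _ hg]
  calc _ = q ((divByMonicLinear g hg).compLeft (Fin n) (i (g • p))) := rfl
    _ = p := by rw [h1]; exact LinearMap.congr_fun hqi p

/-- The quotient of a finitely generated projective `A[X]`-module by a finite free submodule with
a monic denominator is finitely generated and projective over `A`. -/
theorem finite_and_projective_quotient_of_monic {P : Type*} [AddCommGroup P] [Module A P]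
    [Module A[X] P] [IsScalarTower A A[X] P] [Module.Finite A[X] P] [Module.Projective A[X] P]
    (F : Submodule A[X] P) [Module.Free A[X] F] [Module.Finite A[X] F] {g : A[X]}
    (hg : g.Monic) (hF : ∀ p : P, g • p ∈ F) :
    Module.Finite A (P ⧸ F) ∧ Module.Projective A (P ⧸ F) := by
  obtain ⟨h, hh⟩ := exists_leftInverse_smul_of_monic (A := A) (P := P) hg
  let b := Module.Free.chooseBasis A[X] F
  let κ := Module.Free.ChooseBasisIndex A[X] F
  let mulg : P →ₗ[A] F := ((LinearMap.lsmul A[X] P g).codRestrict F hF).restrictScalars A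
  let mk : A[X] →ₗ[A] AdjoinRoot g := (AdjoinRoot.mkₐ g).toLinearMap.restrictScalars A
  let i₀ : P →ₗ[A] (κ → AdjoinRoot g) :=
    mk.compLeft κ ∘ₗ b.equivFun.toLinearMap.restrictScalars A ∘ₗ mulg
  have hi₀ : F.restrictScalars A ≤ LinearMap.ker i₀ := by
    intro f hf
    rw [LinearMap.mem_ker]
    ext1 k
    have h1 : mulg f = g • ⟨f, hf⟩ := rfl
    have h2 : i₀ f k = AdjoinRoot.mk g (b.equivFun (mulg f) k) := rfl
    rw [h2, h1, map_smul, Pi.smul_apply, smul_eq_mul, map_mul, AdjoinRoot.mk_self, zero_mul]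
    rfl
  let q : P →ₗ[A] P ⧸ F := F.mkQ.restrictScalars A
  let i : P ⧸ F →ₗ[A] (κ → AdjoinRoot g) :=
    (F.restrictScalars A).liftQ i₀ hi₀ ∘ₗ
      (Submodule.Quotient.restrictScalarsEquiv A F).symm.toLinearMap
  let t : (κ → A[X]) →ₗ[A] P ⧸ F := q ∘ₗ h ∘ₗ F.subtype.restrictScalars A ∘ₗ
    b.equivFun.symm.toLinearMap.restrictScalars A
  let s : (κ → AdjoinRoot g) →ₗ[A] P ⧸ F := t ∘ₗ (AdjoinRoot.modByMonicHom hg).compLeft κ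
  have hsi : s ∘ₗ i = LinearMap.id := by
    refine LinearMap.ext fun x => ?_
    obtain ⟨p, rfl⟩ := F.mkQ_surjective x
    set c := b.equivFun (mulg p) with hc
    have h1 : (AdjoinRoot.modByMonicHom hg).compLeft κ (i (F.mkQ p)) =
        c - g • fun k => c k /ₘ g := by
      ext1 k
      have h2 : (AdjoinRoot.modByMonicHom hg).compLeft κ (i (F.mkQ p)) k =
          AdjoinRoot.modByMonicHom hg (AdjoinRoot.mk g (c k)) := rfl
      rw [h2, AdjoinRoot.modByMonicHom_mk, Polynomial.modByMonic_eq_sub_mul_div]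
      rfl
    have h3 : s (i (F.mkQ p)) = t (c - g • fun k => c k /ₘ g) := by rw [← h1]; rfl
    have h4 : t c = F.mkQ p := by
      have h5 : t c = q (h (b.equivFun.symm c : F)) := rfl
      rw [h5, hc, LinearEquiv.symm_apply_apply]
      have h6 : ((mulg p : F) : P) = g • p := rfl
      rw [h6, hh]
      rfl
    have h7 (d : κ → A[X]) : t (g • d) = 0 := by
      have h5 : t (g • d) = q (h (b.equivFun.symm (g • d) : F)) := rfl
      rw [h5, map_smul, Submodule.coe_smul, hh]
      exact (Submodule.Quotient.mk_eq_zero F).mpr (Submodule.coe_mem _)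
    rw [LinearMap.comp_apply, h3, map_sub, h4, h7, sub_zero, LinearMap.id_apply]
  have := hg.free_adjoinRoot
  have := hg.finite_adjoinRoot
  exact ⟨Module.Finite.of_surjective s fun x => ⟨i x, LinearMap.congr_fun hsi x⟩,
    Module.Projective.of_split i s hsi⟩

end MonicDenominator

/-- Every nonzero polynomial acquires a unit leading coefficient after a suitable automorphism of
the polynomial ring. -/
def MonicUpToAutomorphism (A : Type*) [CommRing A] : Prop :=
  ∀ f : Polynomial A, f ≠ 0 → ∃ φ : Polynomial A ≃+* Polynomial A, IsUnit (φ f).leadingCoeff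

open Polynomial in
theorem exists_monic_C_mul {A : Type*} [CommRing A] {f : A[X]} (h : IsUnit f.leadingCoeff) :
    ∃ a : Aˣ, (Polynomial.C (a : A) * f).Monic := by
  refine ⟨h.unit⁻¹, ?_⟩
  rw [← Polynomial.smul_eq_C_mul]
  exact Polynomial.monic_of_isUnit_leadingCoeff_inv_smul h

theorem Matrix.VecSimilar.smul_isUnit {ι R : Type*} [Fintype ι] [DecidableEq ι] [CommRing R]
    (v : ι → R) {a : R} (ha : IsUnit a) : VecSimilar v (a • v) :=
  of_isUnit_det (Matrix.scalar ι a) (by simpa using ha.pow _) (by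
    ext; simp [Matrix.scalar_apply, mulVec_diagonal])

open Polynomial in
theorem ProjectivesFree.unimodularVectorsSplit_polynomial {A : Type u} [CommRing A] [IsDomain A]
    (hA : ProjectivesFree A) (hN : MonicUpToAutomorphism A) : UnimodularVectorsSplit A[X] := by
  intro ι _ _ v w hwv
  obtain ⟨i, hi⟩ : ∃ i, v i ≠ 0 := by
    by_contra! h
    simp [dotProduct, h] at hwv
  obtain ⟨φ, hφ⟩ := hN _ hi
  obtain ⟨a, ha⟩ := exists_monic_C_mul hφ
  have hau : IsUnit (Polynomial.C (a : A)) := a.isUnit.map _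
  let v' : ι → A[X] := Polynomial.C (a : A) • (φ ∘ v)
  let w' : ι → A[X] := Polynomial.C (↑a⁻¹ : A) • (φ ∘ w)
  have hwv' : w' ⬝ᵥ v' = 1 := by
    have h1 : (φ ∘ w) ⬝ᵥ (φ ∘ v) = 1 := by
      have := congrArg φ hwv
      simpa [dotProduct, map_sum] using this
    simp only [w', v', smul_dotProduct, dotProduct_smul, h1, smul_eq_mul, mul_one]
    rw [← Polynomial.C_mul]
    simp
  have h1 : VecSimilar (φ ∘ v) v' := VecSimilar.smul_isUnit _ hau
  have h2 := VecSimilar.eval_zero_of_monic (f := v') (i := i) ha hwv'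
  obtain ⟨j, h3⟩ := hA.unimodularVectorsSplit ι (fun k => (v' k).eval 0) (fun k => (w' k).eval 0)
    (by simpa [dotProduct, Polynomial.eval_finsetSum] using congrArg (Polynomial.eval 0) hwv')
  have h4 := ((h1.trans h2).trans (h3.map Polynomial.C)).map (φ.symm : A[X] →+* A[X])
  refine ⟨j, ?_⟩
  convert h4 using 1
  · ext1 k
    simp
  · ext1 k
    by_cases h : k = j
    · subst h; simp
    · simp [h]

/-- The element `g` multiplies the module `P` into a finite free submodule. -/
def IsFreeDenominator (R P : Type*) [CommRing R] [AddCommGroup P] [Module R P] (g : R) : Prop :=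
  ∃ F : Submodule R P, Module.Free R F ∧ Module.Finite R F ∧ ∀ p : P, g • p ∈ F

theorem exists_isFreeDenominator (R P : Type*) [CommRing R] [IsDomain R] [AddCommGroup P]
    [Module R P] [Module.Finite R P] : ∃ g : R, g ≠ 0 ∧ IsFreeDenominator R P g := by
  obtain ⟨s, hs, hli⟩ := exists_set_linearIndependent R P
  have hfin : s.Finite := by
    rw [← Set.finite_coe_iff, ← Cardinal.lt_aleph0_iff_finite, hs]
    exact Module.rank_lt_aleph0 R P
  let F := Submodule.span R s
  have : Module.Finite R F := Module.Finite.span_of_finite R hfin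
  have : Module.Free R F := by
    have h := Module.Basis.span hli
    rw [Subtype.range_coe] at h
    exact Module.Free.of_basis h
  have htors : Module.IsTorsion R (P ⧸ F) := by
    rw [← Module.rank_eq_zero_iff_isTorsion]
    have h1 := Submodule.rank_quotient_add_rank F
    have h2 : Module.rank R F = Module.rank R P := by
      rw [← hs]
      exact rank_span_set hli
    rw [h2] at h1
    exact Cardinal.eq_of_add_eq_add_right (b := Module.rank R P) (by simpa using h1)
      (Module.rank_lt_aleph0 R P)
  obtain ⟨g, hg, hg'⟩ := Submodule.annihilator_top_inter_nonZeroDivisors htors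
  refine ⟨g, nonZeroDivisors.ne_zero hg', F, ‹_›, ‹_›, fun p => ?_⟩
  rw [← Submodule.Quotient.mk_eq_zero, Submodule.Quotient.mk_smul]
  exact Submodule.mem_annihilator.mp hg _ trivial

theorem IsFreeDenominator.mul {R P : Type*} [CommRing R] [AddCommGroup P] [Module R P] {g : R}
    (h : IsFreeDenominator R P g) (a : R) : IsFreeDenominator R P (a * g) := by
  obtain ⟨F, h1, h2, h3⟩ := h
  exact ⟨F, h1, h2, fun p => mul_smul a g p ▸ F.smul_mem a (h3 p)⟩

/-- Freeness of a module may be checked after transporting it along a ring isomorphism. -/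
theorem Module.Free.of_ringEquiv_transport {R S P : Type*} [CommRing R] [CommRing S]
    [AddCommGroup P] [Module R P] [Module.Finite R P] [Module.Projective R P] (e : R ≃+* S)
    (h : ∀ [Module S P] [Module.Finite S P] [Module.Projective S P],
      (∀ g, IsFreeDenominator R P g → IsFreeDenominator S P (e g)) → Module.Free S P) :
    Module.Free R P := by
  let : Module S P := Module.compHom P (e.symm : S →+* R)
  have := RingHomInvPair.of_ringEquiv e
  have := RingHomInvPair.of_ringEquiv e.symm
  let E : P ≃ₛₗ[(e : R →+* S)] P :=
    { AddEquiv.refl P with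
      map_smul' := fun r p => by
        change r • p = (e.symm (e r)) • p
        rw [e.symm_apply_apply] }
  have : Module.Projective S P := Module.Projective.of_equiv E
  have : Module.Finite S P := Module.Finite.of_surjective E.toLinearMap E.surjective
  have hfree : Module.Free S P := by
    refine h fun g ⟨F, h1, h2, h3⟩ => ⟨F.map E.toLinearMap, ?_, ?_, fun p => ?_⟩
    · exact Module.Free.of_equiv (E.submoduleMap F)
    · exact Module.Finite.of_surjective (E.submoduleMap F).toLinearMap (E.submoduleMap F).surjective
    · refine ⟨g • p, h3 p, ?_⟩
      change g • p = (e.symm (e g)) • p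
      rw [e.symm_apply_apply]
  exact Module.Free.of_equiv E.symm

open Polynomial in
theorem ProjectivesFree.free_of_monic {A : Type u} [CommRing A] [IsDomain A]
    (hA : ProjectivesFree A) (hU : UnimodularVectorsSplit A[X]) {P : Type u} [AddCommGroup P]
    [Module A[X] P] [Module.Finite A[X] P] [Module.Projective A[X] P] {g : A[X]} (hg : g.Monic)
    (h : IsFreeDenominator A[X] P g) : Module.Free A[X] P := by
  obtain ⟨F, hF, hF', hgF⟩ := h
  let : Module A P := Module.compHom P (Polynomial.C : A →+* A[X])
  have : IsScalarTower A A[X] P := ⟨fun a p x => by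
    rw [Polynomial.smul_eq_C_mul, mul_smul]
    rfl⟩
  obtain ⟨h1, h2⟩ := finite_and_projective_quotient_of_monic (A := A) F hg hgF
  have : Module.Free A (P ⧸ F) := hA _
  let B := Module.finBasis A (P ⧸ F)
  obtain ⟨e⟩ := nonempty_equiv_ker_linearCombination_basis B
  let φ := Fintype.linearCombination A[X] B
  have hφ : Function.Surjective φ := fun x => by
    refine ⟨fun j => Polynomial.C (B.repr x j), ?_⟩
    conv_rhs => rw [← B.sum_repr x]
    simp only [φ, Fintype.linearCombination_apply]
    refine Finset.sum_congr rfl fun j _ => ?_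
    rw [← Polynomial.algebraMap_eq, algebraMap_smul]
  obtain ⟨α, hα⟩ := Module.projective_lifting_property φ F.mkQ hφ
  obtain ⟨β, hβ⟩ := Module.projective_lifting_property F.mkQ φ F.mkQ_surjective
  have E := schanuelEquiv F.mkQ φ α β hα hβ
  have E' : (P × (Fin (Module.finrank A (P ⧸ F)) → A[X])) ≃ₗ[A[X]]
      ((Fin (Module.finrank A (P ⧸ F)) → A[X]) × F) :=
    (LinearEquiv.refl _ _).prodCongr e ≪≫ₗ E ≪≫ₗ
      (LinearEquiv.refl _ _).prodCongr (LinearEquiv.ofEq _ _ F.ker_mkQ)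
  exact hU.free_of_prod_pi _ (Module.Free.of_equiv E'.symm)

open Polynomial in
theorem ProjectivesFree.polynomial {A : Type u} [CommRing A] [IsDomain A]
    (hA : ProjectivesFree A) (hN : MonicUpToAutomorphism A) : ProjectivesFree A[X] := by
  intro P _ _ _ _
  obtain ⟨g, hg, hgP⟩ := exists_isFreeDenominator A[X] P
  obtain ⟨φ, hφ⟩ := hN g hg
  obtain ⟨a, ha⟩ := exists_monic_C_mul hφ
  have hU := hA.unimodularVectorsSplit_polynomial hN
  exact Module.Free.of_ringEquiv_transport φ fun h => hA.free_of_monic hU ha ((h g hgP).mul _)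

theorem ProjectivesFree.of_ringEquiv {A B : Type u} [CommRing A] [CommRing B] (e : A ≃+* B)
    (hB : ProjectivesFree B) : ProjectivesFree A := by
  intro P _ _ _ _
  exact Module.Free.of_ringEquiv_transport e fun _ => hB P

namespace NagataSubstitution

open Polynomial MvPolynomial Nat RingHom List

variable {k : Type*} [Field k] {n : ℕ} (f : MvPolynomial (Fin (n + 1)) k)
variable (v w : Fin (n + 1) →₀ ℕ)

/-- The substitution fixing `X 0` and mapping `X i` to `X i + c • X 0 ^ N ^ i` for `i ≠ 0`, where
`N` exceeds the total degree of `f`. -/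
noncomputable abbrev shiftHom (c : k) :
    MvPolynomial (Fin (n + 1)) k →ₐ[k] MvPolynomial (Fin (n + 1)) k :=
  MvPolynomial.aeval fun i ↦
    if i = 0 then MvPolynomial.X 0
    else MvPolynomial.X i + c • MvPolynomial.X 0 ^ (2 + f.totalDegree) ^ i.1

theorem shiftHom_comp_shiftHom_neg (c : k) :
    (shiftHom f c).comp (shiftHom f (-c)) = AlgHom.id _ _ := by
  rw [comp_aeval, ← MvPolynomial.aeval_X_left]
  ext i v
  cases i using Fin.cases <;> simp

/-- `shiftHom f 1` as an algebra automorphism. -/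
noncomputable abbrev shift : MvPolynomial (Fin (n + 1)) k ≃ₐ[k] MvPolynomial (Fin (n + 1)) k :=
  AlgEquiv.ofAlgHom (shiftHom f 1) (shiftHom f (-1))
    (shiftHom_comp_shiftHom_neg f 1) (by simpa using shiftHom_comp_shiftHom_neg f (-1))

variable {f v} in
theorem lt_of_mem_ofFn (vlt : ∀ i, v i < 2 + f.totalDegree) :
    ∀ l ∈ ofFn v, l < 2 + f.totalDegree := by
  grind

theorem sum_pow_mul_ne (vlt : ∀ i, v i < 2 + f.totalDegree) (wlt : ∀ i, w i < 2 + f.totalDegree)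
    (ne : v ≠ w) :
    ∑ x : Fin (n + 1), (2 + f.totalDegree) ^ x.1 * v x ≠
      ∑ x : Fin (n + 1), (2 + f.totalDegree) ^ x.1 * w x := by
  intro h
  refine ne <| Finsupp.ext <| congrFun <| ofFn_inj.mp ?_
  apply ofDigits_inj_of_len_eq (Nat.lt_add_right f.totalDegree one_lt_two)
    (by simp) (lt_of_mem_ofFn vlt) (lt_of_mem_ofFn wlt)
  simpa only [ofDigits_eq_sum_mapIdx, mapIdx_eq_ofFn, get_ofFn, length_ofFn,
    Fin.val_cast, mul_comm, sum_ofFn] using! h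

theorem degreeOf_zero_shift_monomial {a : k} (ha : a ≠ 0) :
    ((shift f) (MvPolynomial.monomial v a)).degreeOf 0 =
      ∑ i : Fin (n + 1), (2 + f.totalDegree) ^ i.1 * v i := by
  rw [← natDegree_finSuccEquiv, MvPolynomial.monomial_eq,
    Finsupp.prod_pow v fun a ↦ MvPolynomial.X a]
  simp only [Fin.prod_univ_succ, Fin.sum_univ_succ, map_mul, map_prod, map_pow,
    AlgEquiv.ofAlgHom_apply, MvPolynomial.aeval_C, MvPolynomial.aeval_X, if_pos, Fin.succ_ne_zero,
    ite_false, one_smul, map_add, finSuccEquiv_X_zero, finSuccEquiv_X_succ,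
    MvPolynomial.algebraMap_eq]
  have h (i : Fin n) :
      (Polynomial.C (MvPolynomial.X (R := k) i) +
        Polynomial.X ^ (2 + f.totalDegree) ^ i.succ.1) ^ v i.succ ≠ 0 :=
    pow_ne_zero (v i.succ) (leadingCoeff_ne_zero.mp <| by simp [add_comm, leadingCoeff_X_pow_add_C])
  rw [natDegree_mul (by simp [ha]) (mul_ne_zero (by simp) (Finset.prod_ne_zero_iff.mpr
    (fun i _ ↦ h i))), natDegree_mul (by simp) (Finset.prod_ne_zero_iff.mpr (fun i _ ↦ h i)),
    natDegree_prod _ _ (fun i _ ↦ h i), natDegree_finSuccEquiv, degreeOf_C]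
  simpa only [natDegree_pow, zero_add, natDegree_X, mul_one, Fin.val_zero, pow_zero, one_mul,
    add_right_inj] using Finset.sum_congr rfl (fun i _ ↦ by
    rw [add_comm (Polynomial.C _), natDegree_X_pow_add_C, mul_comm])

theorem degreeOf_zero_shift_ne_of_ne (hv : v ∈ f.support) (hw : w ∈ f.support) (ne : v ≠ w) :
    (shift f <| MvPolynomial.monomial v <| MvPolynomial.coeff v f).degreeOf 0 ≠
    (shift f <| MvPolynomial.monomial w <| MvPolynomial.coeff w f).degreeOf 0 := by
  rw [degreeOf_zero_shift_monomial _ _ <| MvPolynomial.mem_support_iff.mp hv,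
    degreeOf_zero_shift_monomial _ _ <| MvPolynomial.mem_support_iff.mp hw]
  refine sum_pow_mul_ne f v w (fun i ↦ ?_) (fun i ↦ ?_) ne <;>
  exact lt_of_le_of_lt ((monomial_le_degreeOf i ‹_›).trans (degreeOf_le_totalDegree f i))
    (by lia)

theorem leadingCoeff_finSuccEquiv_shift_monomial :
    (finSuccEquiv k n ((shift f)
      ((MvPolynomial.monomial v) (MvPolynomial.coeff v f)))).leadingCoeff =
    algebraMap k _ (MvPolynomial.coeff v f) := by
  rw [MvPolynomial.monomial_eq, Finsupp.prod_fintype]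
  · simp only [map_mul, map_prod, leadingCoeff_mul, leadingCoeff_prod]
    rw [AlgEquiv.ofAlgHom_apply, MvPolynomial.algHom_C, MvPolynomial.algebraMap_eq,
      finSuccEquiv_apply, eval₂Hom_C, coe_comp]
    simp only [AlgEquiv.ofAlgHom_apply, Function.comp_apply, leadingCoeff_C, map_pow,
      leadingCoeff_pow, MvPolynomial.algebraMap_eq]
    have : ∀ j, ((finSuccEquiv k n) ((shiftHom f) 1 (MvPolynomial.X j))).leadingCoeff = 1 :=
      fun j ↦ by
      by_cases h : j = 0
      · simp [h, finSuccEquiv_apply]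
      · simp only [aeval_eq_bind₁, bind₁_X_right, if_neg h, one_smul, map_add, map_pow]
        obtain ⟨i, rfl⟩ := Fin.exists_succ_eq.mpr h
        simp [finSuccEquiv_X_succ, finSuccEquiv_X_zero, add_comm]
    simp only [this, one_pow, Finset.prod_const_one, mul_one]
  exact fun i ↦ pow_zero _

theorem isUnit_leadingCoeff_shift (fne : f ≠ 0) :
    IsUnit (finSuccEquiv k n (shift f f)).leadingCoeff := by
  obtain ⟨v, vin, vs⟩ := Finset.exists_max_image f.support
    (fun v ↦ (shift f ((MvPolynomial.monomial v) (MvPolynomial.coeff v f))).degreeOf 0)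
    (MvPolynomial.support_nonempty.mpr fne)
  set h := fun w ↦ (MvPolynomial.monomial w) (MvPolynomial.coeff w f)
  simp only [← natDegree_finSuccEquiv] at vs
  replace vs : ∀ x ∈ f.support \ {v}, (finSuccEquiv k n ((shift f) (h x))).degree <
      (finSuccEquiv k n ((shift f) (h v))).degree := by
    intro x hx
    obtain ⟨h1, h2⟩ := Finset.mem_sdiff.mp hx
    apply degree_lt_degree <| lt_of_le_of_ne (vs x h1) ?_
    simpa only [natDegree_finSuccEquiv]
      using degreeOf_zero_shift_ne_of_ne f _ _ h1 vin <| ne_of_not_mem_cons h2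
  have coeff : (finSuccEquiv k n ((shift f) (h v + ∑ x ∈ f.support \ {v}, h x))).leadingCoeff =
      (finSuccEquiv k n ((shift f) (h v))).leadingCoeff := by
    simp only [map_add, map_sum]
    rw [add_comm]
    apply leadingCoeff_add_of_degree_lt <| (lt_of_le_of_lt <| degree_sum_le _ _) ?_
    have h2 : h v ≠ 0 := by simpa [h] using MvPolynomial.mem_support_iff.mp vin
    replace h2 : (finSuccEquiv k n ((shift f) (h v))) ≠ 0 := fun eq ↦ h2 <|
      by simpa only [map_eq_zero_iff _ (AlgEquiv.injective _)] using eq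
    exact (Finset.sup_lt_iff <| Ne.bot_lt (fun x ↦ h2 <| degree_eq_bot.mp x)).mpr vs
  nth_rw 2 [← f.support_sum_monomial_coeff]
  rw [Finset.sum_eq_add_sum_sdiff_singleton_of_mem vin h]
  rw [leadingCoeff_finSuccEquiv_shift_monomial] at coeff
  simpa only [coeff, MvPolynomial.algebraMap_eq] using
    (MvPolynomial.mem_support_iff.mp vin).isUnit.map MvPolynomial.C

end NagataSubstitution

theorem monicUpToAutomorphism_mvPolynomial (K : Type*) [Field K] (n : ℕ) :
    MonicUpToAutomorphism (MvPolynomial (Fin n) K) := by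
  intro g hg
  let e := finSuccEquiv K n
  refine ⟨((e.symm.trans (NagataSubstitution.shift (e.symm g))).trans e).toRingEquiv, ?_⟩
  exact NagataSubstitution.isUnit_leadingCoeff_shift (e.symm g) (by simpa using hg)

/-- The **Quillen–Suslin theorem**. -/
theorem projectivesFree_mvPolynomial (K : Type u) [Field K] (n : ℕ) :
    ProjectivesFree (MvPolynomial (Fin n) K) := by
  induction n with
  | zero =>
    exact ProjectivesFree.of_ringEquiv (isEmptyRingEquiv K (Fin 0))
      fun P _ _ _ _ => inferInstance
  | succ n ih =>
    exact ProjectivesFree.of_ringEquiv (finSuccEquiv K n).toRingEquiv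
      (ih.polynomial (monicUpToAutomorphism_mvPolynomial K n))

section Minors

variable {R : Type*} [CommRing R]

theorem Matrix.det_mul_eq_sum_submatrix {m n : Type*} [Fintype m] [Fintype n] [DecidableEq n]
    (M : Matrix n m R) (N : Matrix m n R) :
    (M * N).det = ∑ f : n → m, (∏ i, N (f i) i) * (M.submatrix id f).det := by
  classical
  have h : (M * N)ᵀ = fun i => ∑ k, N k i • Mᵀ k := by
    ext i j
    simp [Matrix.mul_apply, mul_comm]
  rw [← det_transpose, h]
  refine (detRowAlternating.toMultilinearMap.map_sum fun i k => N k i • Mᵀ k).trans ?_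
  refine Finset.sum_congr rfl fun f _ => ?_
  rw [MultilinearMap.map_smul_univ, smul_eq_mul, ← det_transpose (M.submatrix id f)]
  rfl

theorem Matrix.det_submatrix_mem_span_minorsSet {l m k : ℕ} (F : Matrix (Fin l) (Fin m) R)
    (ri : Fin k → Fin l) (ci : Fin k → Fin m) (hri : Function.Injective ri) :
    (F.submatrix ri ci).det ∈ Ideal.span (minorsSet k F) := by
  by_cases h : Function.Injective ci
  · exact Ideal.subset_span ⟨ri, ci, hri, h, rfl⟩
  · obtain ⟨i, j, hij, hne⟩ : ∃ i j, ci i = ci j ∧ i ≠ j := by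
      simpa [Function.Injective] using h
    rw [det_zero_of_column_eq hne (by simp [hij])]
    exact zero_mem _

theorem Matrix.det_mul_submatrix_mem_span_minorsSet {l m k : ℕ} (F : Matrix (Fin l) (Fin m) R)
    (B : Matrix (Fin m) (Fin k) R) (ri : Fin k → Fin l) (hri : Function.Injective ri) :
    ((F * B).submatrix ri id).det ∈ Ideal.span (minorsSet k F) := by
  rw [← submatrix_mul_equiv F B ri (Equiv.refl _) id, det_mul_eq_sum_submatrix]
  exact sum_mem fun f _ => Ideal.mul_mem_left _ _ (F.det_submatrix_mem_span_minorsSet ri f hri)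

theorem dvd_of_mem_span_of_forall_dvd {s : Set R} {d x : R} (h : ∀ a ∈ s, d ∣ a)
    (hx : x ∈ Ideal.span s) : d ∣ x := by
  rw [← Ideal.mem_span_singleton]
  exact Ideal.span_le.mpr (fun a ha => Ideal.mem_span_singleton.mpr (h a ha)) hx

theorem ZLP.of_mul_eq_one {m r : ℕ} {C : Matrix (Fin r) (Fin m) R} {B : Matrix (Fin m) (Fin r) R}
    (h : C * B = 1) : ZLP C := by
  rw [ZLP, Ideal.eq_top_iff_one]
  simpa [h] using C.det_mul_submatrix_mem_span_minorsSet B id Function.injective_id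

theorem JEqTop.of_mul_eq_one [IsDomain R] {l m r : ℕ} {F : Matrix (Fin l) (Fin m) R}
    {C : Matrix (Fin r) (Fin m) R} {B : Matrix (Fin m) (Fin r) R} {d : R}
    (hd : IsGcdMinors r F d) (hd0 : d ≠ 0)
    (hJ : Ideal.span {b : R | d * b ∈ minorsSet r F} = ⊤)
    (hF : F = F * B * C) : JEqTop r (F * B) := by
  have hdvd : ∀ ri : Fin r → Fin l, Function.Injective ri → d ∣ ((F * B).submatrix ri id).det :=
    fun ri hri => dvd_of_mem_span_of_forall_dvd hd.1
      (F.det_mul_submatrix_mem_span_minorsSet B ri hri)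
  have hdet : ∀ (ri : Fin r → Fin l) (ci : Fin r → Fin m), (F.submatrix ri ci).det =
      ((F * B).submatrix ri id).det * (C.submatrix id ci).det := by
    intro ri ci
    rw [← det_mul]
    conv_lhs => rw [hF, ← submatrix_mul_equiv (F * B) C ri (Equiv.refl _) ci]
    rfl
  refine ⟨d, ⟨?_, fun e he => hd.2 e ?_⟩, ?_⟩
  · rintro _ ⟨ri, ci, hri, hci, rfl⟩
    have h := submatrix_mul_equiv F B ri (Equiv.refl _) ci
    rw [← h]
    have h2 := F.det_mul_submatrix_mem_span_minorsSet (B.submatrix id ci) ri hri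
    rw [← submatrix_mul_equiv _ _ ri (Equiv.refl _) id] at h2
    exact dvd_of_mem_span_of_forall_dvd hd.1 h2
  · rintro _ ⟨ri, ci, hri, hci, rfl⟩
    rw [hdet]
    exact Dvd.dvd.mul_right (he _ ⟨ri, id, hri, Function.injective_id, rfl⟩) _
  · rw [eq_top_iff, ← hJ, Ideal.span_le]
    rintro b ⟨ri, ci, hri, hci, hb⟩
    obtain ⟨g, hg⟩ := hdvd ri hri
    rw [hdet, hg, mul_assoc] at hb
    rw [mul_left_cancel₀ hd0 hb]
    exact Ideal.mul_mem_right _ _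
      (Ideal.subset_span ⟨ri, id, hri, Function.injective_id, hg.symm⟩)

theorem IsGcdMinors.dvd_adjugate_mul {l m r : ℕ} {F : Matrix (Fin l) (Fin m) R} {d : R}
    (hd : IsGcdMinors r F d) (ri : Fin r → Fin l) (ci : Fin r → Fin m)
    (hri : Function.Injective ri) :
    ∃ Q : Matrix (Fin r) (Fin m) R,
      d • Q = (F.submatrix ri ci).adjugate * F.submatrix ri id := by
  have h : ∀ j c, d ∣ ((F.submatrix ri ci).adjugate * F.submatrix ri id) j c := by
    intro j c
    have h1 : ((F.submatrix ri ci).adjugate * F.submatrix ri id) j c =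
        (F.submatrix ri (Function.update ci j c)).det := by
      have h2 : F.submatrix ri (Function.update ci j c) =
          (F.submatrix ri ci).updateCol j (fun i => F (ri i) c) := by
        ext a b
        by_cases hb : b = j
        · subst hb; simp
        · simp [hb]
      rw [h2, ← cramer_apply, cramer_eq_adjugate_mulVec]
      rfl
    rw [h1]
    exact dvd_of_mem_span_of_forall_dvd hd.1 (F.det_submatrix_mem_span_minorsSet ri _ hri)
  choose Q hQ using h
  exact ⟨Matrix.of Q, by ext j c; simp [hQ]⟩

end Minors

section Rank

variable {L : Type*} [Field L]

theorem Matrix.exists_rank_submatrix_cols_eq {ι : Type*} [Fintype ι] {m r : ℕ}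
    (M : Matrix ι (Fin m) L) (hr : M.rank = r) :
    ∃ ci : Fin r → Fin m, Function.Injective ci ∧ (M.submatrix id ci).rank = r := by
  obtain ⟨κ, a, ha, hspan, hli⟩ := exists_linearIndependent' L M.col
  have : Finite κ := Finite.of_injective a ha
  have := Fintype.ofFinite κ
  have hcard : Fintype.card κ = r := by
    rw [← hr, rank_eq_finrank_span_cols, ← hspan, finrank_span_eq_card hli]
  let e : Fin r ≃ κ := (finCongr hcard.symm).trans (Fintype.equivFin κ).symm
  refine ⟨a ∘ e, ha.comp e.injective, ?_⟩
  have h : Set.range (M.submatrix id (a ∘ e)).col = Set.range (M.col ∘ a) := by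
    rw [show (M.submatrix id (a ∘ e)).col = (M.col ∘ a) ∘ e from rfl, EquivLike.range_comp]
  rw [rank_eq_finrank_span_cols, h, hspan, ← rank_eq_finrank_span_cols, hr]

theorem Matrix.exists_det_submatrix_ne_zero {l m r : ℕ} (M : Matrix (Fin l) (Fin m) L)
    (hr : M.rank = r) :
    ∃ (ri : Fin r → Fin l) (ci : Fin r → Fin m), Function.Injective ri ∧ Function.Injective ci ∧
      (M.submatrix ri ci).det ≠ 0 := by
  obtain ⟨ci, hci, h1⟩ := M.exists_rank_submatrix_cols_eq hr
  obtain ⟨ri, hri, h2⟩ := (M.submatrix id ci)ᵀ.exists_rank_submatrix_cols_eq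
    ((rank_transpose _).trans h1)
  refine ⟨ri, ci, hri, hci, fun h0 => ?_⟩
  have h4 : (M.submatrix ri ci).rank = r := by
    rw [← rank_transpose]
    exact h2
  obtain ⟨v, hv, hv0⟩ := exists_mulVec_eq_zero_iff.mpr h0
  have h5 : LinearIndependent L (M.submatrix ri ci).col := by
    rw [linearIndependent_iff_card_eq_finrank_span, Set.finrank, ← rank_eq_finrank_span_cols, h4,
      Fintype.card_fin]
  exact hv (Matrix.mulVec_injective_iff.mpr h5 (by simpa using hv0))

theorem Matrix.mul_adjugate_mul_eq_det_smul {l m r : ℕ} (M : Matrix (Fin l) (Fin m) L)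
    (hr : M.rank = r) (ri : Fin r → Fin l) (ci : Fin r → Fin m)
    (hdet : (M.submatrix ri ci).det ≠ 0) :
    M.submatrix id ci * ((M.submatrix ri ci).adjugate * M.submatrix ri id) =
      (M.submatrix ri ci).det • M := by
  have hle : Submodule.span L (Set.range (M.submatrix id ci).col) ≤
      Submodule.span L (Set.range M.col) :=
    Submodule.span_mono (by rintro _ ⟨j, rfl⟩; exact ⟨ci j, rfl⟩)
  have heq := Submodule.eq_of_le_of_finrank_le hle (by
    rw [← rank_eq_finrank_span_cols, ← rank_eq_finrank_span_cols, hr]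
    calc r = (M.submatrix ri ci).rank := by rw [rank_of_det_ne_zero hdet, Fintype.card_fin]
      _ = ((M.submatrix id ci).submatrix ri id).rank := rfl
      _ ≤ _ := rank_submatrix_le _ _ _)
  have h : ∀ c, ∃ t : Fin r → L, (M.submatrix id ci) *ᵥ t = M.col c := by
    intro c
    have hc : M.col c ∈ Submodule.span L (Set.range (M.submatrix id ci).col) :=
      heq ▸ Submodule.subset_span ⟨c, rfl⟩
    rwa [← range_mulVecLin] at hc
  choose t ht using h
  obtain ⟨T, hT⟩ : ∃ T : Matrix (Fin r) (Fin m) L, M = M.submatrix id ci * T :=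
    ⟨(Matrix.of t)ᵀ, by ext i c; exact (congrFun (ht c) i).symm⟩
  have h1 : M.submatrix ri id = M.submatrix ri ci * T := by
    conv_lhs => rw [hT]
    rfl
  rw [h1, ← Matrix.mul_assoc (adjugate _), adjugate_mul, smul_mul, Matrix.one_mul,
    Matrix.mul_smul, ← hT]

end Rank

section Factorization

variable {R : Type u} [CommRing R] [IsDomain R] (L : Type*) [Field L] [Algebra R L]
  [IsFractionRing R L]

theorem JEqTop.exists_mul_eq_self {l m r : ℕ} {F : Matrix (Fin l) (Fin m) R}
    (hr : (F.map (algebraMap R L)).rank = r) {d : R} (hd : IsGcdMinors r F d) (hd0 : d ≠ 0)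
    (hJ : Ideal.span {b : R | d * b ∈ minorsSet r F} = ⊤) :
    ∃ (E : Matrix (Fin m) (Fin m) R) (X : Matrix (Fin m) (Fin l) R),
      F * E = F ∧ d • E = X * F := by
  have hinj := IsFractionRing.injective R L
  let S : Submodule R R :=
    { carrier := {b | ∃ (E : Matrix (Fin m) (Fin m) R) (X : Matrix (Fin m) (Fin l) R),
        F * E = b • F ∧ d • E = X * F}
      zero_mem' := ⟨0, 0, by simp, by simp⟩
      add_mem' := by
        rintro a b ⟨E, X, h1, h2⟩ ⟨E', X', h1', h2'⟩
        exact ⟨E + E', X + X', by rw [Matrix.mul_add, h1, h1', add_smul],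
          by rw [Matrix.add_mul, smul_add, h2, h2']⟩
      smul_mem' := by
        rintro c b ⟨E, X, h1, h2⟩
        exact ⟨c • E, c • X, by rw [Matrix.mul_smul, h1, smul_smul, smul_eq_mul],
          by rw [Matrix.smul_mul, ← h2, smul_comm]⟩ }
  have hS : Ideal.span {b : R | d * b ∈ minorsSet r F} ≤ S := by
    refine Submodule.span_le.mpr ?_
    rintro b ⟨ri, ci, hri, hci, hb⟩
    rcases eq_or_ne b 0 with rfl | hb0
    · exact S.zero_mem
    obtain ⟨Q, hQ⟩ := hd.dvd_adjugate_mul ri ci hri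
    have hF : F.submatrix id ci * ((F.submatrix ri ci).adjugate * F.submatrix ri id) =
        (F.submatrix ri ci).det • F := by
      have hmap : ((F.map (algebraMap R L)).submatrix ri ci) =
          (algebraMap R L).mapMatrix (F.submatrix ri ci) := rfl
      have h := (F.map (algebraMap R L)).mul_adjugate_mul_eq_det_smul hr ri ci (by
        rw [hmap, ← RingHom.map_det, ← hb]
        exact (map_ne_zero_iff _ hinj).mpr (mul_ne_zero hd0 hb0))
      rw [hmap, ← RingHom.map_det, ← RingHom.map_adjugate] at h
      refine Matrix.map_injective hinj ?_
      beta_reduce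
      rw [Matrix.map_mul, Matrix.map_mul]
      exact h.trans (by ext; simp)
    have hcol : F * (1 : Matrix (Fin m) (Fin m) R).submatrix id ci = F.submatrix id ci := by
      ext i j
      simp [Matrix.mul_apply, Matrix.one_apply]
    have hrow : (1 : Matrix (Fin l) (Fin l) R).submatrix ri id * F = F.submatrix ri id := by
      ext i j
      simp [Matrix.mul_apply, Matrix.one_apply]
    refine ⟨(1 : Matrix (Fin m) (Fin m) R).submatrix id ci * Q,
      (1 : Matrix (Fin m) (Fin m) R).submatrix id ci * ((F.submatrix ri ci).adjugate *
        (1 : Matrix (Fin l) (Fin l) R).submatrix ri id), ?_, ?_⟩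
    · refine smul_right_injective _ hd0 ?_
      change d • _ = d • _
      rw [← Matrix.mul_assoc, hcol, ← Matrix.mul_smul, hQ, hF, ← hb, mul_smul]
    · rw [← Matrix.mul_smul, hQ, Matrix.mul_assoc, Matrix.mul_assoc, hrow]
  obtain ⟨E, X, h1, h2⟩ := hS (hJ ▸ Submodule.mem_top : (1 : R) ∈ _)
  exact ⟨E, X, by rw [h1, one_smul], h2⟩

theorem ProjectivesFree.exists_factorization_of_isIdempotentElem (hR : ProjectivesFree R) {m : ℕ}
    {E : Matrix (Fin m) (Fin m) R} (hE : IsIdempotentElem E) :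
    ∃ (k : ℕ) (B : Matrix (Fin m) (Fin k) R) (C : Matrix (Fin k) (Fin m) R),
      B * C = E ∧ C * B = 1 := by
  let f := toLin' E
  let p := f.rangeRestrict
  let i := (LinearMap.range f).subtype
  have hff : ∀ x, f (f x) = f x := fun x => by
    rw [toLin'_apply, toLin'_apply, mulVec_mulVec, hE.eq]
  have hpi : p ∘ₗ i = LinearMap.id := by
    refine LinearMap.ext ?_
    rintro ⟨_, y, rfl⟩
    exact Subtype.ext (hff y)
  have : Module.Projective R (LinearMap.range f) := Module.Projective.of_split i p hpi
  have : Module.Free R (LinearMap.range f) := hR _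
  let e := (Module.finBasis R (LinearMap.range f)).equivFun
  refine ⟨_, LinearMap.toMatrix' (i ∘ₗ e.symm.toLinearMap),
    LinearMap.toMatrix' (e.toLinearMap ∘ₗ p), ?_, ?_⟩
  · rw [← LinearMap.toMatrix'_comp, LinearMap.comp_assoc, ← LinearMap.comp_assoc p,
      LinearEquiv.symm_comp, LinearMap.id_comp]
    exact LinearMap.toMatrix'_toLin' E
  · rw [← LinearMap.toMatrix'_comp, LinearMap.comp_assoc, ← LinearMap.comp_assoc _ i, hpi,
      LinearMap.id_comp, LinearEquiv.comp_symm, LinearMap.toMatrix'_id]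

theorem JEqTop.exists_factorization (hR : ProjectivesFree R) {l m r : ℕ}
    {F : Matrix (Fin l) (Fin m) R} (hr : (F.map (algebraMap R L)).rank = r) (hJ : JEqTop r F) :
    ∃ (G : Matrix (Fin l) (Fin r) R) (F1 : Matrix (Fin r) (Fin m) R),
      F = G * F1 ∧ ZLP F1 ∧ JEqTop r G := by
  have hinj := IsFractionRing.injective R L
  obtain ⟨d, hd, hJ⟩ := hJ
  have hd0 : d ≠ 0 := by
    rintro rfl
    obtain ⟨ri, ci, hri, hci, h⟩ := (F.map (algebraMap R L)).exists_det_submatrix_ne_zero hr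
    rw [show (F.map (algebraMap R L)).submatrix ri ci =
      (algebraMap R L).mapMatrix (F.submatrix ri ci) from rfl, ← RingHom.map_det,
      zero_dvd_iff.mp (hd.1 _ ⟨ri, ci, hri, hci, rfl⟩)] at h
    exact h (map_zero _)
  obtain ⟨E, X, hFE, hEX⟩ := JEqTop.exists_mul_eq_self L hr hd hd0 hJ
  have hE : IsIdempotentElem E := by
    refine smul_right_injective _ hd0 ?_
    change d • _ = d • _
    rw [← smul_mul, hEX, Matrix.mul_assoc, hFE]
  obtain ⟨k, B, C, hBC, hCB⟩ := hR.exists_factorization_of_isIdempotentElem hE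
  have hF : F = F * B * C := by rw [Matrix.mul_assoc, hBC, hFE]
  have hk : k = r := by
    apply le_antisymm
    · have h : d • (1 : Matrix (Fin k) (Fin k) R) = C * X * (F * B) := by
        calc d • (1 : Matrix (Fin k) (Fin k) R) = C * (d • E) * B := by
              rw [← hBC, Matrix.mul_smul, Matrix.smul_mul, Matrix.mul_assoc, Matrix.mul_assoc,
                hCB, Matrix.mul_one, hCB]
          _ = _ := by rw [hEX]; simp only [Matrix.mul_assoc]
      have h2 := congrArg (fun M : Matrix _ _ R => (M.map (algebraMap R L)).rank) h
      simp only [Matrix.map_mul] at h2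
      calc k = ((d • (1 : Matrix (Fin k) (Fin k) R)).map (algebraMap R L)).rank := by
            rw [rank_of_det_ne_zero, Fintype.card_fin]
            rw [← RingHom.mapMatrix_apply, ← RingHom.map_det, map_ne_zero_iff _ hinj]
            simp [hd0]
        _ ≤ r := by
            rw [h2, ← hr]
            exact (rank_mul_le_right _ _).trans (rank_mul_le_left _ _)
    · rw [← hr, hF, Matrix.map_mul]
      exact (rank_mul_le_right _ _).trans (by simpa using rank_le_height (C.map (algebraMap R L)))
  subst hk
  exact ⟨F * B, C, hF, ZLP.of_mul_eq_one hCB, JEqTop.of_mul_eq_one hd hd0 hJ hF⟩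

end Factorization

/-- If `F ∈ R^{l×m}` has normal rank `r` and `J_r(F) = R`, then
`F = G * F₁` with `F₁ ∈ R^{r×m}` ZLP, `G ∈ R^{l×r}`, and `J_r(G) = R`. -/
theorem statement13 {K : Type*} [Field K] {n l m r : ℕ}
    (F : Matrix (Fin l) (Fin m) (MvPolynomial (Fin n) K))
    (hrank : normalRank F = r)
    (hJ : JEqTop r F) :
    ∃ (G : Matrix (Fin l) (Fin r) (MvPolynomial (Fin n) K))
      (F1 : Matrix (Fin r) (Fin m) (MvPolynomial (Fin n) K)),
      F = G * F1 ∧ ZLP F1 ∧ JEqTop r G :=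
  JEqTop.exists_factorization (FractionRing (MvPolynomial (Fin n) K))
    (projectivesFree_mvPolynomial K n) hrank hJ
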